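/- The limit, as x tends to 0 from the right, of 6·(x - (1+x²)^{1/6}·arsinh(x)) / ((x² + 6 - 6·(1+x²)^{1/6})·arsinh(x)) equals 8/25. -/

import Mathlib

open Filter Topology in
lemma tendsto_sq_nhdsGT_zero : Tendsto (fun x : ℝ => x ^ 2) (𝓝[>] 0) (𝓝[>] 0) := by
  refine tendsto_nhdsWithin_iff.2 ⟨?_, ?_⟩
  · have h : ContinuousAt (fun t : ℝ => t ^ 2) 0 := by fun_prop
    simpa using h.tendsto.mono_left nhdsWithin_le_nhds
  · filter_upwards [self_mem_nhdsWithin] with x hx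
    exact pow_pos (Set.mem_Ioi.1 hx) 2

open Filter Topology in
/-- The second-order Taylor limit of `(1 + t) ^ a` at `0`, from the right. -/
lemma tendsto_one_add_rpow_sub_div_sq (a : ℝ) :
    Tendsto (fun t : ℝ => ((1 + t) ^ a - 1 - a * t) / t ^ 2) (𝓝[>] 0) (𝓝 (a * (a - 1) / 2)) := by
  have hd : ∀ b t : ℝ, 0 ≤ t → HasDerivAt (fun t : ℝ => (1 + t) ^ b) (b * (1 + t) ^ (b - 1)) t := by
    intro b t ht
    have h := ((hasDerivAt_id t).const_add 1).rpow_const (p := b)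
      (Or.inl (by simp only [id]; positivity))
    simpa using h
  have hpos : ∀ᶠ t : ℝ in 𝓝[>] 0, 0 < t := eventually_mem_nhdsWithin
  refine HasDerivAt.lhopital_zero_nhdsGT
    (f' := fun t => a * (1 + t) ^ (a - 1) - a) (g' := fun t => 2 * t) ?_ ?_ ?_ ?_ ?_ ?_
  · filter_upwards [hpos] with t ht
    exact (((hd a t ht.le).sub_const 1).sub ((hasDerivAt_id t).const_mul a)).congr_deriv (by simp)
  · filter_upwards with t
    simpa using hasDerivAt_pow 2 t
  · filter_upwards [hpos] with t ht
    positivity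
  · have h : ContinuousAt (fun t : ℝ => (1 + t) ^ a - 1 - a * t) 0 :=
      ((hd a 0 le_rfl).continuousAt.sub continuousAt_const).sub (by fun_prop)
    simpa using h.tendsto.mono_left nhdsWithin_le_nhds
  · have h : ContinuousAt (fun t : ℝ => t ^ 2) 0 := by fun_prop
    simpa using h.tendsto.mono_left nhdsWithin_le_nhds
  · have h := (hasDerivAt_iff_tendsto_slope.1 (hd (a - 1) 0 le_rfl)).mono_left
      (nhdsGT_le_nhdsNE 0)
    have h2 := h.const_mul (a / 2)
    simp only [add_zero, Real.one_rpow, mul_one] at h2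
    rw [show a * (a - 1) / 2 = a / 2 * (a - 1) by ring]
    refine h2.congr' ?_
    filter_upwards [hpos] with t ht
    simp only [slope_def_field, add_zero, Real.one_rpow, sub_zero]
    field_simp

open Filter Topology in
lemma tendsto_mul_rpow_sub_arsinh_div_pow_five :
    Tendsto (fun x : ℝ => (x * (1 + x ^ 2) ^ (-(1 : ℝ) / 6) - Real.arsinh x) / x ^ 5)
      (𝓝[>] 0) (𝓝 (1 / 45)) := by
  have hpos : ∀ᶠ x : ℝ in 𝓝[>] 0, 0 < x := eventually_mem_nhdsWithin
  have hcont : ∀ b : ℝ, Continuous fun x : ℝ => (1 + x ^ 2) ^ b := fun b =>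
    Continuous.rpow_const (by fun_prop) (fun x => Or.inl (by positivity))
  refine HasDerivAt.lhopital_zero_nhdsGT
    (f' := fun x => (1 + x ^ 2) ^ (-(7 : ℝ) / 6) * (1 + 2 / 3 * x ^ 2 - (1 + x ^ 2) ^ ((2 : ℝ) / 3)))
    (g' := fun x => 5 * x ^ 4) ?_ ?_ ?_ ?_ ?_ ?_
  · filter_upwards with x
    have hx : 0 < 1 + x ^ 2 := by positivity
    have h1 := ((hasDerivAt_pow 2 x).const_add 1).rpow_const (p := -(1 : ℝ) / 6) (Or.inl hx.ne')
    have h2 := ((hasDerivAt_id x).mul h1).sub (Real.hasDerivAt_arsinh x)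
    refine h2.congr_deriv ?_
    have e1 : (1 + x ^ 2) ^ (-(1 : ℝ) / 6) = (1 + x ^ 2) ^ (-(7 : ℝ) / 6) * (1 + x ^ 2) := by
      rw [← Real.rpow_add_one hx.ne']; norm_num
    have e2 : (√(1 + x ^ 2))⁻¹ = (1 + x ^ 2) ^ (-(7 : ℝ) / 6) * (1 + x ^ 2) ^ ((2 : ℝ) / 3) := by
      rw [← Real.rpow_add hx, Real.sqrt_eq_rpow, ← Real.rpow_neg hx.le]; norm_num
    have e3 : -(1 : ℝ) / 6 - 1 = -7 / 6 := by norm_num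
    rw [e2, e3, e1]
    simp only [id]
    push_cast
    ring
  · filter_upwards with x
    simpa using hasDerivAt_pow 5 x
  · filter_upwards [hpos] with x hx
    positivity
  · have h : Continuous fun x : ℝ => x * (1 + x ^ 2) ^ (-(1 : ℝ) / 6) - Real.arsinh x :=
      (continuous_id.mul (hcont _)).sub Real.continuous_arsinh
    simpa using (h.tendsto 0).mono_left nhdsWithin_le_nhds
  · have h : ContinuousAt (fun t : ℝ => t ^ 5) 0 := by fun_prop
    simpa using h.tendsto.mono_left nhdsWithin_le_nhds
  · have h1 := (tendsto_one_add_rpow_sub_div_sq (2 / 3)).comp tendsto_sq_nhdsGT_zero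
    have h2 := ((hcont (-(7 : ℝ) / 6)).tendsto 0).mono_left (nhdsWithin_le_nhds (s := Set.Ioi 0))
    have h3 := (h2.mul h1).mul_const (-1 / 5)
    convert h3.congr' ?_ using 2
    · norm_num
    · filter_upwards [hpos] with x hx
      simp only [Function.comp]
      field_simp
      ring

theorem stmt_16 :
    Filter.Tendsto (fun x : ℝ =>
      6 * (x - (1 + x ^ 2) ^ ((1 : ℝ)/6) * Real.arsinh x) /
        ((x ^ 2 + 6 - 6 * (1 + x ^ 2) ^ ((1 : ℝ)/6)) * Real.arsinh x))
      (nhdsWithin 0 (Set.Ioo 0 1)) (nhds (8/25)) := by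
  open Filter Topology in
  refine Tendsto.mono_left ?_ (nhdsWithin_mono 0 Set.Ioo_subset_Ioi_self)
  have hpos : ∀ᶠ x : ℝ in 𝓝[>] 0, 0 < x := eventually_mem_nhdsWithin
  have hu : Tendsto (fun x : ℝ => (1 + x ^ 2) ^ ((1 : ℝ) / 6)) (𝓝[>] 0) (𝓝 1) := by
    have h : Continuous fun x : ℝ => (1 + x ^ 2) ^ ((1 : ℝ) / 6) :=
      Continuous.rpow_const (by fun_prop) (fun x => Or.inl (by positivity))
    simpa using (h.tendsto 0).mono_left nhdsWithin_le_nhds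
  have hD := (tendsto_one_add_rpow_sub_div_sq (1 / 6)).comp tendsto_sq_nhdsGT_zero
  have hA : Tendsto (fun x : ℝ => Real.arsinh x / x) (𝓝[>] 0) (𝓝 1) := by
    have h := (hasDerivAt_iff_tendsto_slope.1 (Real.hasDerivAt_arsinh 0)).mono_left
      (nhdsGT_le_nhdsNE 0)
    simpa [slope_fun_def_field] using h
  have hN := (hu.mul tendsto_mul_rpow_sub_arsinh_div_pow_five).const_mul 6
  have h := hN.div ((hD.const_mul (-6)).mul hA) (by norm_num)
  convert h.congr' ?_ using 2
  · norm_num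
  · filter_upwards [hpos] with x hx
    have hx1 : 0 < 1 + x ^ 2 := by positivity
    have e : (1 + x ^ 2) ^ ((1 : ℝ) / 6) * (1 + x ^ 2) ^ (-(1 : ℝ) / 6) = 1 := by
      rw [← Real.rpow_add hx1]; norm_num
    have eN : 6 * ((1 + x ^ 2) ^ ((1 : ℝ) / 6) *
        ((x * (1 + x ^ 2) ^ (-(1 : ℝ) / 6) - Real.arsinh x) / x ^ 5)) =
        6 * (x - (1 + x ^ 2) ^ ((1 : ℝ) / 6) * Real.arsinh x) / x ^ 5 := by
      linear_combination 6 * x / x ^ 5 * e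
    have eD : -6 * (((1 + x ^ 2) ^ ((1 : ℝ) / 6) - 1 - 1 / 6 * x ^ 2) / (x ^ 2) ^ 2) *
        (Real.arsinh x / x) =
        (x ^ 2 + 6 - 6 * (1 + x ^ 2) ^ ((1 : ℝ) / 6)) * Real.arsinh x / x ^ 5 := by
      generalize (1 + x ^ 2) ^ ((1 : ℝ) / 6) = u
      field_simp
      ring
    simp only [Pi.div_apply, Function.comp]
    rw [eN, eD, div_div_div_cancel_right₀ (by positivity)]
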